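/- Let G be a nonempty position with no 3-chains and no 4-loops, and suppose c(G) ≤ 4. Then v(G) = 3 if size(G) is odd, and otherwise v(G) is whichever of 2 and 4 is congruent to size(G) mod 4. Furthermore, if c(G) < 2 then G has at least two 6-loops and opening a 6-loop is optimal. -/

import Mathlib

namespace DotsAndBoxes

/-- A component of a Dots & Boxes endgame position: an `n`-chain or an `n`-loop. -/
inductive Component : Type where
  | chain (n : ℕ)
  | loop (n : ℕ)
deriving DecidableEq

namespace Component

/-- The number of boxes in a component. -/
def size : Component → ℕ
  | chain n => n
  | loop n => n

def isChain : Component → Bool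
  | chain _ => true
  | loop _ => false

def isLoop : Component → Bool
  | chain _ => false
  | loop _ => true

/-- A chain must have length at least 3; a loop must have even length at least 4. -/
def Valid : Component → Prop
  | chain n => 3 ≤ n
  | loop n => 4 ≤ n ∧ Even n

end Component

/-- A position is a finite multiset of components. -/
abbrev Position := Multiset Component

def Position.Valid (G : Position) : Prop := ∀ C ∈ G, C.Valid

/-- The number of unclaimed boxes in a position. -/
def size (G : Position) : ℕ := (G.map Component.size).sum

/-- The number of chains of a position. -/
def numChains (G : Position) : ℕ := Multiset.card (G.filter fun C => C.isChain = true)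

/-- The number of loops of a position. -/
def numLoops (G : Position) : ℕ := Multiset.card (G.filter fun C => C.isLoop = true)

/-- θ(G), the number of 3-chains. -/
def theta (G : Position) : ℕ := G.count (Component.chain 3)

/-- f(G), the number of 4-loops. -/
def numF (G : Position) : ℕ := G.count (Component.loop 4)

/-- s(G), the number of 6-loops. -/
def numS (G : Position) : ℕ := G.count (Component.loop 6)

open Classical in
/-- The terminal bonus tb(G). -/
noncomputable def tb (G : Position) : ℤ :=
  if G = 0 then 0
  else if ∀ C ∈ G, C.isLoop = true then 8
  else if (∃ C ∈ G, C.isLoop = true) ∧ Component.chain 3 ∈ G ∧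
      (∀ C ∈ G, C.isChain = true → C = Component.chain 3) then 6
  else 4

/-- The controlled value c(G). -/
noncomputable def cval (G : Position) : ℤ :=
  (size G : ℤ) - 4 * (numChains G : ℤ) - 8 * (numLoops G : ℤ) + tb G

/-- The score v(G;C) of opening component `C`, given that the remainder of the
position has value `w`. -/
def openVal (C : Component) (w : ℤ) : ℤ :=
  match C with
  | Component.chain n => ((n : ℤ) - 2) + |w - 2|
  | Component.loop n => ((n : ℤ) - 4) + |w - 4|

/-- Auxiliary recursion (on the number of components) for the value `v`. -/
noncomputable def valueAux : ℕ → Position → ℤ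
  | 0, _ => 0
  | n + 1, G =>
    if G = 0 then 0
    else sInf { x : ℤ | ∃ C ∈ G, x = openVal C (valueAux n (G.erase C)) }

/-- The value v(G): v(∅) = 0, and v(G) = min over components C of G of v(G;C). -/
noncomputable def value (G : Position) : ℤ := valueAux (Multiset.card G) G

/-- v(G;C), the value of G given that the opener has just opened C. -/
noncomputable def valueOpen (G : Position) (C : Component) : ℤ :=
  openVal C (value (G.erase C))

/-- Opening a component C of G is optimal if C ∈ G and v(G;C) = v(G). -/
def Optimal (G : Position) (C : Component) : Prop :=
  C ∈ G ∧ valueOpen G C = value G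

/-- Every chain has length at least 4, every loop length at least 6. -/
def Good (G : Position) : Prop :=
  ∀ C ∈ G, match C with
    | Component.chain n => 4 ≤ n
    | Component.loop n => 6 ≤ n ∧ Even n

theorem Good.erase {G : Position} (h : Good G) (C : Component) : Good (G.erase C) :=
  fun D hD => h D (Multiset.mem_of_mem_erase hD)

theorem value_spec (G : Position) (hne : G ≠ 0) :
    (∀ C ∈ G, value G ≤ valueOpen G C) ∧ ∃ C ∈ G, value G = valueOpen G C := by
  obtain ⟨n, hn⟩ : ∃ n, Multiset.card G = n + 1 :=
    ⟨Multiset.card G - 1, by have := Multiset.card_pos.2 hne; omega⟩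
  have hv : value G = sInf { x : ℤ | ∃ C ∈ G, x = valueOpen G C } := by
    unfold value
    rw [hn, valueAux, if_neg hne]
    congr 1
    ext x
    constructor
    · rintro ⟨C, hC, rfl⟩
      refine ⟨C, hC, ?_⟩
      unfold valueOpen value
      rw [Multiset.card_erase_of_mem hC, hn]; rfl
    · rintro ⟨C, hC, rfl⟩
      refine ⟨C, hC, ?_⟩
      unfold valueOpen value
      rw [Multiset.card_erase_of_mem hC, hn]; rfl
  have hfin : { x : ℤ | ∃ C ∈ G, x = valueOpen G C }.Finite := by
    have : { x : ℤ | ∃ C ∈ G, x = valueOpen G C } =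
        Set.image (fun C => valueOpen G C) (G.toFinset : Set Component) := by
      ext x
      simp [eq_comm]
    rw [this]
    exact (Finset.finite_toSet _).image _
  have hnon : { x : ℤ | ∃ C ∈ G, x = valueOpen G C }.Nonempty := by
    obtain ⟨C, hC⟩ := Multiset.exists_mem_of_ne_zero hne
    exact ⟨_, C, hC, rfl⟩
  constructor
  · intro C hC
    rw [hv]
    exact csInf_le hfin.bddBelow ⟨C, hC, rfl⟩
  · rw [hv]
    exact Int.csInf_mem hnon hfin.bddBelow

/-- The controlled value without the terminal bonus. -/
def base (G : Position) : ℤ :=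
  (size G : ℤ) - 4 * (numChains G : ℤ) - 8 * (numLoops G : ℤ)

theorem base_cons_chain (n : ℕ) (G : Position) :
    base (Component.chain n ::ₘ G) = base G + n - 4 := by
  have h1 : (Component.chain n).isChain = true := rfl
  have h2 : (Component.chain n).isLoop = false := rfl
  have h3 : (Component.chain n).size = n := rfl
  simp only [base, size, numChains, numLoops, Multiset.map_cons, Multiset.sum_cons,
    Multiset.filter_cons, h1, h2, h3, if_true, Multiset.card_add, Multiset.card_singleton]
  simp
  ring

theorem base_cons_loop (n : ℕ) (G : Position) :
    base (Component.loop n ::ₘ G) = base G + n - 8 := by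
  have h1 : (Component.loop n).isChain = false := rfl
  have h2 : (Component.loop n).isLoop = true := rfl
  have h3 : (Component.loop n).size = n := rfl
  simp only [base, size, numChains, numLoops, Multiset.map_cons, Multiset.sum_cons,
    Multiset.filter_cons, h1, h2, h3, if_true, Multiset.card_add, Multiset.card_singleton]
  simp
  ring

theorem base_erase_chain {n : ℕ} {G : Position} (h : Component.chain n ∈ G) :
    base (G.erase (Component.chain n)) = base G - n + 4 := by
  conv_rhs => rw [← Multiset.cons_erase h, base_cons_chain]
  ring

theorem base_erase_loop {n : ℕ} {G : Position} (h : Component.loop n ∈ G) :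
    base (G.erase (Component.loop n)) = base G - n + 8 := by
  conv_rhs => rw [← Multiset.cons_erase h, base_cons_loop]
  ring

theorem base_ge (G : Position) (h : Good G) : -2 * (numS G : ℤ) ≤ base G := by
  induction G using Multiset.induction_on with
  | empty => simp [base, size, numChains, numLoops, numS]
  | cons C G ih =>
    have ih' := ih (fun D hD => h D (Multiset.mem_cons_of_mem hD))
    have hC := h C (Multiset.mem_cons_self _ _)
    cases C with
    | chain n =>
      rw [base_cons_chain]
      simp only [numS] at *
      rw [Multiset.count_cons_of_ne (by simp)]
      have hC : 4 ≤ n := hC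
      omega
    | loop n =>
      rw [base_cons_loop]
      simp only [numS] at *
      obtain ⟨h6, k, hk⟩ := hC
      by_cases hn : n = 6
      · subst hn
        rw [Multiset.count_cons_self]
        push_cast
        omega
      · rw [Multiset.count_cons_of_ne (by simp; omega)]
        omega

theorem tb_good {G : Position} (h : Good G) (hne : G ≠ 0) :
    ((∀ C ∈ G, C.isLoop = true) ∧ tb G = 8) ∨ ((∃ n, Component.chain n ∈ G) ∧ tb G = 4) := by
  by_cases hl : ∀ C ∈ G, C.isLoop = true
  · left
    refine ⟨hl, ?_⟩
    unfold tb
    rw [if_neg hne, if_pos hl]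
  · right
    have h3 : Component.chain 3 ∉ G := fun h3 => by
      have := h _ h3
      simp at this
    constructor
    · push Not at hl
      obtain ⟨C, hC, hCl⟩ := hl
      cases C with
      | chain n => exact ⟨n, hC⟩
      | loop n => simp [Component.isLoop] at hCl
    · unfold tb
      rw [if_neg hne, if_neg hl, if_neg (fun hh => h3 hh.2.1)]

theorem cval_eq (G : Position) : cval G = base G + tb G := rfl

theorem cval_erase_loop {n : ℕ} {G : Position} (h : Good G) (hm : Component.loop n ∈ G)
    (hne : G.erase (Component.loop n) ≠ 0) :
    cval (G.erase (Component.loop n)) = cval G - n + 8 := by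
  have hG : G ≠ 0 := fun h0 => by simp [h0] at hm
  rw [cval_eq, cval_eq, base_erase_loop hm]
  have : tb (G.erase (Component.loop n)) = tb G := by
    rcases tb_good h hG with ⟨h1, h2⟩ | ⟨⟨m, h1⟩, h2⟩ <;>
    rcases tb_good (h.erase _) hne with ⟨h3, h4⟩ | ⟨⟨k, h3⟩, h4⟩
    · rw [h2, h4]
    · have := h1 _ (Multiset.mem_of_mem_erase h3)
      simp [Component.isLoop] at this
    · have := h3 (Component.chain m) ((Multiset.mem_erase_of_ne (by simp)).2 h1)
      simp [Component.isLoop] at this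
    · rw [h2, h4]
  rw [this]; ring

theorem cval_erase_chain {n : ℕ} {G : Position} (h : Good G) (hm : Component.chain n ∈ G)
    (hne : G.erase (Component.chain n) ≠ 0) :
    cval (G.erase (Component.chain n)) = cval G - n + 4 ∨
    cval (G.erase (Component.chain n)) = cval G - n + 8 ∧
      ∃ m, Component.loop m ∈ G := by
  have hG : G ≠ 0 := fun h0 => by simp [h0] at hm
  rw [cval_eq, cval_eq, base_erase_chain hm]
  have h2 : tb G = 4 := by
    rcases tb_good h hG with ⟨h1, h2⟩ | ⟨⟨m, h1⟩, h2⟩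
    · have := h1 _ hm
      simp [Component.isLoop] at this
    · exact h2
  rcases tb_good (h.erase _) hne with ⟨h3, h4⟩ | ⟨⟨k, h3⟩, h4⟩
  · right
    refine ⟨by rw [h2, h4]; ring, ?_⟩
    obtain ⟨C, hC⟩ := Multiset.exists_mem_of_ne_zero hne
    have := h3 C hC
    cases C with
    | chain m => simp [Component.isLoop] at this
    | loop m => exact ⟨m, Multiset.mem_of_mem_erase hC⟩
  · left
    rw [h2, h4]; ring

theorem erase_zero {G : Position} {C : Component} (h : C ∈ G) (h0 : G.erase C = 0) :
    G = {C} := by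
  rw [← Multiset.cons_erase h, h0]; rfl

theorem value_zero : value 0 = 0 := by simp [value, valueAux]

theorem single {G : Position} (hg : Good G) {C : Component} (h : C ∈ G)
    (h0 : G.erase C = 0) : value G = cval G ∧ 4 ≤ cval G := by
  have hG := erase_zero h h0
  subst hG
  obtain ⟨-, D, hD, hv⟩ := value_spec {C} (by simp)
  rw [Multiset.mem_singleton] at hD
  subst hD
  have hC := hg D h
  rw [hv, valueOpen, h0, value_zero]
  cases D with
  | chain n =>
    simp only at hC
    have : cval {Component.chain n} = n := by
      have hb := base_cons_chain n 0
      have hb0 : base 0 = 0 := by simp [base, size, numChains, numLoops]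
      have ht : tb {Component.chain n} = 4 := by simp [tb, Component.isLoop]
      rw [cval_eq, ht]
      change base {Component.chain n} = _ at hb
      omega
    rw [this]
    simp [openVal]; omega
  | loop n =>
    simp only at hC
    have : cval {Component.loop n} = n := by
      have hb := base_cons_loop n 0
      have hb0 : base 0 = 0 := by simp [base, size, numChains, numLoops]
      have ht : tb {Component.loop n} = 8 := by simp [tb, Component.isLoop]
      rw [cval_eq, ht]
      change base {Component.loop n} = _ at hb
      omega
    rw [this]
    simp [openVal]; omega

theorem main (G : Position) : Good G → G ≠ 0 →
    (2 ≤ cval G → value G = cval G) ∧ cval G ≤ value G ∧ (2 ≤ value G ∧ value G % 2 = cval G % 2) ∧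
    (cval G < 2 → (cval G % 4 = 0 → value G = 4) ∧ (cval G % 4 = 2 → value G = 2) ∧
      (cval G % 2 = 1 → value G = 3) ∧ 2 ≤ numS G ∧ Optimal G (Component.loop 6)) := by
  induction G using Multiset.strongInductionOn with
  | ih G ih =>
  intro hg hne
  have IH : ∀ C ∈ G, G.erase C ≠ 0 → _ := fun C hC h0 =>
    ih (G.erase C) (Multiset.erase_lt.2 hC) (hg.erase C) h0
  by_cases hs : ∃ C ∈ G, G.erase C = 0
  · obtain ⟨C, hC, h0⟩ := hs
    have := single hg hC h0
    refine ⟨fun _ => this.1, by omega, ⟨by omega, by omega⟩, fun _ => by omega⟩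
  push Not at hs
  obtain ⟨hle, D, hD, hv⟩ := value_spec G hne
  have htb : 4 ≤ tb G := by
    rcases tb_good hg hne with ⟨_, h⟩ | ⟨_, h⟩ <;> omega
  have hbase := base_ge G hg
  have hceq := cval_eq G
  -- lower bounds
  have hlow : cval G ≤ value G ∧ (2 ≤ value G ∧ value G % 2 = cval G % 2) := by
    rw [hv]
    have hd := hg D hD
    obtain ⟨-, i2, i3, -⟩ := IH D hD (hs D hD)
    cases D with
    | chain n =>
      simp only at hd
      have := cval_erase_chain hg hD (hs _ hD)
      simp only [valueOpen, openVal]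
      rw [abs_of_nonneg (by omega)]
      omega
    | loop n =>
      simp only at hd
      have := cval_erase_loop hg hD (hs _ hD)
      simp only [valueOpen, openVal]
      obtain ⟨hd6, k, hk⟩ := hd
      rcases abs_cases (value (G.erase (Component.loop n)) - 4) with ha | ha <;> omega
  have hsix : Component.loop 6 ∉ G → numS G = 0 := fun h => Multiset.count_eq_zero.2 h
  refine ⟨fun hc => le_antisymm ?_ hlow.1, hlow.1, hlow.2, fun hc => ?_⟩
  · by_cases h6 : Component.loop 6 ∈ G
    · have h1 := hle _ h6
      have h2 := cval_erase_loop hg h6 (hs _ h6)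
      have h3 := (IH _ h6 (hs _ h6)).1 (by push_cast at h2; omega)
      simp only [valueOpen, openVal] at h1
      rw [abs_of_nonneg (by push_cast at h2; omega)] at h1
      push_cast at h1 h2
      omega
    · have hs0 := hsix h6
      by_cases hl : ∃ n, Component.loop n ∈ G
      · obtain ⟨n, hn⟩ := hl
        have h1 := hle _ hn
        have h2 := cval_erase_loop hg hn (hs _ hn)
        have hb := base_ge _ (hg.erase (Component.loop n))
        have hsz : numS (G.erase (Component.loop n)) = 0 :=
          Multiset.count_eq_zero.2 (fun h => h6 (Multiset.mem_of_mem_erase h))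
        have hb4 := cval_eq (G.erase (Component.loop n))
        have htb' : 4 ≤ tb (G.erase (Component.loop n)) := by
          rcases tb_good (hg.erase _) (hs _ hn) with ⟨_, h⟩ | ⟨_, h⟩ <;> omega
        have h3 := (IH _ hn (hs _ hn)).1 (by omega)
        simp only [valueOpen, openVal] at h1
        rw [abs_of_nonneg (by omega)] at h1
        omega
      · cases D with
        | loop n => exact absurd ⟨n, hD⟩ hl
        | chain n =>
          have h1 := hle _ hD
          have h2 : cval (G.erase (Component.chain n)) = cval G - n + 4 := by
            rcases cval_erase_chain hg hD (hs _ hD) with h | ⟨_, h⟩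
            · exact h
            · exact absurd h hl
          have hb := base_ge _ (hg.erase (Component.chain n))
          have hsz : numS (G.erase (Component.chain n)) = 0 :=
            Multiset.count_eq_zero.2 (fun h => h6 (Multiset.mem_of_mem_erase h))
          have hb4 := cval_eq (G.erase (Component.chain n))
          have htb' : 4 ≤ tb (G.erase (Component.chain n)) := by
            rcases tb_good (hg.erase _) (hs _ hD) with ⟨_, h⟩ | ⟨_, h⟩ <;> omega
          have h3 := (IH _ hD (hs _ hD)).1 (by omega)
          simp only [valueOpen, openVal] at h1
          rw [abs_of_nonneg (by omega)] at h1
          omega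
  · have hS : 2 ≤ numS G := by omega
    have h6 : Component.loop 6 ∈ G := by
      by_contra h
      have := hsix h
      omega
    have h1 := hle _ h6
    have h2 := cval_erase_loop hg h6 (hs _ h6)
    obtain ⟨j1, j2, j3, j4⟩ := IH _ h6 (hs _ h6)
    have hD2 : value G = 2 → cval G % 4 = 2 := by
      intro hv2
      rw [hv2] at hv
      have hd := hg D hD
      obtain ⟨i1, i2, i3, i4⟩ := IH D hD (hs D hD)
      cases D with
      | chain n =>
        simp only at hd
        have := cval_erase_chain hg hD (hs _ hD)
        simp only [valueOpen, openVal] at hv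
        rw [abs_of_nonneg (by omega)] at hv
        have hn : n = 4 := by omega
        subst hn
        push_cast at *
        omega
      | loop n =>
        simp only at hd
        have := cval_erase_loop hg hD (hs _ hD)
        simp only [valueOpen, openVal] at hv
        have a1 := le_abs_self (value (G.erase (Component.loop n)) - 4)
        have a2 := neg_abs_le (value (G.erase (Component.loop n)) - 4)
        have a3 := abs_nonneg (value (G.erase (Component.loop n)) - 4)
        have hn : n = 6 := by omega
        subst hn
        push_cast at *
        omega
    have hopt : valueOpen G (Component.loop 6) =
        2 + (4 - value (G.erase (Component.loop 6))) := by
      simp only [valueOpen, openVal]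
      push_cast at h2
      rw [abs_of_nonpos (by omega)]
      push_cast
      ring
    have hl2 := hlow.2
    push_cast at h2
    have hcase : cval G % 4 = 0 ∧ value (G.erase (Component.loop 6)) = 2 ∨
        cval G % 4 = 2 ∧ value (G.erase (Component.loop 6)) = 4 ∨
        cval G % 2 = 1 ∧ value (G.erase (Component.loop 6)) = 3 := by
      by_cases hc' : 2 ≤ cval (G.erase (Component.loop 6))
      · have := j1 hc'
        omega
      · obtain ⟨k1, k2, k3, -⟩ := j4 (by omega)
        omega
    have hval : value G = valueOpen G (Component.loop 6) ∧
        (cval G % 4 = 0 → value G = 4) ∧ (cval G % 4 = 2 → value G = 2) ∧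
        (cval G % 2 = 1 → value G = 3) := by
      clear hv j1 j2 j3 j4 hceq
      rcases hcase with ⟨ha, hb⟩ | ⟨ha, hb⟩ | ⟨ha, hb⟩
      · have h3 : value G ≠ 3 := by omega
        refine ⟨?_, ?_, ?_, ?_⟩ <;> omega
      · refine ⟨?_, ?_, ?_, ?_⟩ <;> omega
      · refine ⟨?_, ?_, ?_, ?_⟩ <;> omega
    exact ⟨hval.2.1, hval.2.2.1, hval.2.2.2, hS, h6, hval.1.symm⟩

/-- Example of 6-loop optimality: if G is nonempty with no 3-chains, no 4-loops,
and c(G) ≤ 4, then v(G) = 3 when size(G) is odd, and otherwise v(G) is whichever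
of 2 and 4 is congruent to size(G) mod 4; moreover if c(G) < 2 then G has at least
two 6-loops and opening a 6-loop is optimal. -/
theorem six_loop_optimality (G : Position) (hG : G.Valid) (hne : G ≠ 0)
    (hth : theta G = 0) (hf : numF G = 0) (hc : cval G ≤ 4) :
    (Odd (size G) → value G = 3) ∧
    (size G % 4 = 2 → value G = 2) ∧
    (size G % 4 = 0 → value G = 4) ∧
    (cval G < 2 → 2 ≤ numS G ∧ Optimal G (Component.loop 6)) := by
  have hg : Good G := by
    intro C hC
    have hv := hG C hC
    cases C with
    | chain n =>
      simp only [Component.Valid] at hv ⊢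
      have : n ≠ 3 := by
        rintro rfl
        exact Multiset.count_eq_zero.1 hth hC
      omega
    | loop n =>
      simp only [Component.Valid] at hv ⊢
      obtain ⟨h4, k, hk⟩ := hv
      have : n ≠ 4 := by
        rintro rfl
        exact Multiset.count_eq_zero.1 hf hC
      exact ⟨by omega, k, hk⟩
  obtain ⟨m1, m2, m3, m4⟩ := main G hg hne
  have hmod : cval G % 4 = (size G : ℤ) % 4 := by
    have htb : tb G = 8 ∨ tb G = 4 := by
      rcases tb_good hg hne with ⟨_, h⟩ | ⟨_, h⟩ <;> omega
    unfold cval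
    omega
  refine ⟨?_, ?_, ?_, fun h => (m4 h).2.2.2⟩
  · rintro ⟨k, hk⟩
    omega
  · intro h
    omega
  · intro h
    omega

end DotsAndBoxes
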